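/- Let α ∈ ℝ, α ≠ 0, and set E₁ := −exp(4π/α) and E := −E₁ = exp(4π/α) > 0. Then for every λ ∈ ℂ\{0}: d(k_E(λ)) := 1 − (α/(2π))·ln(|Re k_E(λ)| + |Im k_E(λ)|) = 0 if and only if |λ| = 1. In particular, for every real vector k ∈ ℝ² with |k| = √E = exp(2π/α) one has 1 − (α/(2π))·ln|k| = 0; i.e., at the energy E = |E₁| the circle of real momenta of length √E consists of real exceptional points, where the data h± and the boundary values μ± of the Faddeev eigenfunctions are not well-defined. -/

import Mathlib

/-- The principal square root of a real number, viewed in `ℂ`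
(so `√E = i√(−E)` for `E < 0`). -/
noncomputable def sqrtC (E : ℝ) : ℂ := (E : ℂ) ^ (1/2 : ℂ)

/-- The rational parametrization `k_E(λ) = ((λ + λ⁻¹)√E/2, i(λ⁻¹ − λ)√E/2) ∈ ℂ²`
of the fixed-energy surface `{k ∈ ℂ² : k² = E}`. -/
noncomputable def kE (E : ℝ) (lam : ℂ) : ℂ × ℂ :=
  ((lam + lam⁻¹) * sqrtC E / 2, Complex.I * (lam⁻¹ - lam) * sqrtC E / 2)

/-- Euclidean norm `|Re k|` of the componentwise real part of `k ∈ ℂ²`. -/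
noncomputable def normRe (k : ℂ × ℂ) : ℝ := Real.sqrt (k.1.re ^ 2 + k.2.re ^ 2)

/-- Euclidean norm `|Im k|` of the componentwise imaginary part of `k ∈ ℂ²`. -/
noncomputable def normIm (k : ℂ × ℂ) : ℝ := Real.sqrt (k.1.im ^ 2 + k.2.im ^ 2)

/-- The denominator `d(k) = 1 − (α/2π)·ln(|Re k| + |Im k|)` of the Faddeev generalized
scattering data `a(k) = b(k) = (2π)⁻²·α/d(k)` of the 2D point potential of strength `α`. -/
noncomputable def dFad (α : ℝ) (k : ℂ × ℂ) : ℝ :=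
  1 - α / (2 * Real.pi) * Real.log (normRe k + normIm k)

lemma sqrtC_exp (t : ℝ) : sqrtC (Real.exp (2 * t)) = ((Real.exp t : ℝ) : ℂ) := by
  unfold sqrtC
  have h : ((1/2 : ℂ)) = (((1/2 : ℝ)) : ℂ) := by push_cast; rfl
  rw [h, ← Complex.ofReal_cpow (Real.exp_pos _).le, ← Real.exp_mul]
  congr 2
  ring

lemma normRe_kE (t : ℝ) (z : ℂ) (hz : z ≠ 0) :
    normRe (kE (Real.exp (2 * t)) z) = Real.exp t / 2 * (‖z‖ + ‖z‖⁻¹) := by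
  have hr : 0 < ‖z‖ := norm_pos_iff.mpr hz
  have hs := Real.exp_pos t
  unfold normRe kE
  rw [sqrtC_exp]
  have e : ‖z‖ ^ 2 = z.re ^ 2 + z.im ^ 2 := by
    rw [Complex.sq_norm, Complex.normSq_apply]; ring
  have h1 : ((z + z⁻¹) * ((Real.exp t : ℝ) : ℂ) / 2).re
      = Real.exp t / 2 * (z.re + z.re / ‖z‖ ^ 2) := by
    rw [Complex.div_ofNat_re, Complex.re_mul_ofReal, Complex.add_re, Complex.inv_re,
      ← Complex.sq_norm]; ring
  have h2 : (Complex.I * (z⁻¹ - z) * ((Real.exp t : ℝ) : ℂ) / 2).re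
      = Real.exp t / 2 * (z.im + z.im / ‖z‖ ^ 2) := by
    rw [Complex.div_ofNat_re, Complex.re_mul_ofReal, Complex.I_mul_re, Complex.sub_im,
      Complex.inv_im, ← Complex.sq_norm]; ring
  simp only [h1, h2]
  have : (Real.exp t / 2 * (z.re + z.re / ‖z‖ ^ 2)) ^ 2 +
      (Real.exp t / 2 * (z.im + z.im / ‖z‖ ^ 2)) ^ 2 =
      (Real.exp t / 2) ^ 2 * (1 + 1 / ‖z‖ ^ 2) ^ 2 * (z.re ^ 2 + z.im ^ 2) := by ring
  have h3 : (Real.exp t / 2) ^ 2 * (1 + 1 / ‖z‖ ^ 2) ^ 2 * ‖z‖ ^ 2 =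
      (Real.exp t / 2 * (‖z‖ + ‖z‖⁻¹)) ^ 2 := by
    field_simp
  rw [this, ← e, h3, Real.sqrt_sq (by positivity)]

lemma normIm_kE (t : ℝ) (z : ℂ) (hz : z ≠ 0) :
    normIm (kE (Real.exp (2 * t)) z) = Real.exp t / 2 * |‖z‖ - ‖z‖⁻¹| := by
  have hr : 0 < ‖z‖ := norm_pos_iff.mpr hz
  have hs := Real.exp_pos t
  unfold normIm kE
  rw [sqrtC_exp]
  have e : ‖z‖ ^ 2 = z.re ^ 2 + z.im ^ 2 := by
    rw [Complex.sq_norm, Complex.normSq_apply]; ring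
  have h1 : ((z + z⁻¹) * ((Real.exp t : ℝ) : ℂ) / 2).im
      = Real.exp t / 2 * (z.im - z.im / ‖z‖ ^ 2) := by
    rw [Complex.div_ofNat_im, Complex.im_mul_ofReal, Complex.add_im, Complex.inv_im,
      ← Complex.sq_norm]; ring
  have h2 : (Complex.I * (z⁻¹ - z) * ((Real.exp t : ℝ) : ℂ) / 2).im
      = Real.exp t / 2 * (z.re / ‖z‖ ^ 2 - z.re) := by
    rw [Complex.div_ofNat_im, Complex.im_mul_ofReal, Complex.I_mul_im, Complex.sub_re,
      Complex.inv_re, ← Complex.sq_norm]; ring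
  simp only [h1, h2]
  have : (Real.exp t / 2 * (z.im - z.im / ‖z‖ ^ 2)) ^ 2 +
      (Real.exp t / 2 * (z.re / ‖z‖ ^ 2 - z.re)) ^ 2 =
      (Real.exp t / 2) ^ 2 * (1 - 1 / ‖z‖ ^ 2) ^ 2 * (z.re ^ 2 + z.im ^ 2) := by ring
  have h3 : (Real.exp t / 2) ^ 2 * (1 - 1 / ‖z‖ ^ 2) ^ 2 * ‖z‖ ^ 2 =
      (Real.exp t / 2 * (‖z‖ - ‖z‖⁻¹)) ^ 2 := by
    field_simp
  rw [this, ← e, h3, Real.sqrt_sq_eq_abs, abs_mul, abs_of_pos (by positivity)]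

lemma d_zero_iff (α : ℝ) (hα : α ≠ 0) (x : ℝ) (hx : 0 < x) :
    1 - α / (2 * Real.pi) * Real.log x = 0 ↔ x = Real.exp (2 * Real.pi / α) := by
  have hp := Real.pi_ne_zero
  have key : x = Real.exp (2 * Real.pi / α) ↔ Real.log x = 2 * Real.pi / α :=
    ⟨fun h => by rw [h, Real.log_exp], fun h => by rw [← h, Real.exp_log hx]⟩
  rw [key]
  constructor
  · intro h
    field_simp at h ⊢
    linarith
  · intro h
    rw [h]
    field_simp
    ring

/-- Let `α ≠ 0`, `E₁ := −exp(4π/α)`, `E := −E₁ = exp(4π/α)`. Then for every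
`λ ∈ ℂ\{0}`: `d(k_E(λ)) = 0 ↔ |λ| = 1`; in particular for every real momentum
`k ∈ ℝ²` with `|k| = √E = exp(2π/α)` one has `1 − (α/2π) ln|k| = 0` (real exceptional
points at the energy `E = |E₁|`). -/
theorem point_potential_real_exceptional_points
    (α : ℝ) (hα : α ≠ 0) :
    (∀ lam : ℂ, lam ≠ 0 →
      (dFad α (kE (Real.exp (4 * Real.pi / α)) lam) = 0 ↔ ‖lam‖ = 1)) ∧
    (∀ k : EuclideanSpace ℝ (Fin 2), ‖k‖ = Real.exp (2 * Real.pi / α) →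
      1 - α / (2 * Real.pi) * Real.log ‖k‖ = 0) := by
  constructor
  · intro z hz
    have hr : 0 < ‖z‖ := norm_pos_iff.mpr hz
    have hs := Real.exp_pos (2 * Real.pi / α)
    have h4 : 4 * Real.pi / α = 2 * (2 * Real.pi / α) := by ring
    unfold dFad
    rw [h4, normRe_kE _ z hz, normIm_kE _ z hz, d_zero_iff α hα _ (by positivity)]
    generalize Real.exp (2 * Real.pi / α) = s at *
    have hi : ‖z‖ * ‖z‖⁻¹ = 1 := mul_inv_cancel₀ hr.ne'
    have hip : 0 < ‖z‖⁻¹ := inv_pos.mpr hr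
    constructor
    · intro h
      have h5 : ‖z‖ + ‖z‖⁻¹ + |‖z‖ - ‖z‖⁻¹| = 2 := by
        have : s * (‖z‖ + ‖z‖⁻¹ + |‖z‖ - ‖z‖⁻¹|) = s * 2 := by linarith
        exact mul_left_cancel₀ hs.ne' this
      have h6 := le_abs_self (‖z‖ - ‖z‖⁻¹)
      have h7 := neg_abs_le (‖z‖ - ‖z‖⁻¹)
      have h8 : ‖z‖ ≤ 1 := by linarith
      have h9 : ‖z‖⁻¹ ≤ 1 := by linarith
      nlinarith
    · intro h
      rw [h]
      norm_num
  · intro k hk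
    rw [d_zero_iff α hα _ (by rw [hk]; exact Real.exp_pos _), hk]
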